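/- Let (X,d,W) be a nonempty uniformly convex hyperbolic space having a monotone modulus of uniform convexity η, C ⊆ X a nonempty convex subset, and T : C → C asymptotically nonexpansive with sequence (k_n) in [0,∞) satisfying Σ_{i=0}^∞ k_i < ∞. Let (λ_n) be a sequence in [a,b] for some 0 < a < b < 1. If T has a fixed point, then T is λ_n-asymptotically regular: for every x ∈ C the Krasnoselski–Mann iteration (x_n) starting from x satisfies lim_{n→∞} d(x_n, T x_n) = 0. -/

import Mathlib

open Filter Set

section Hyperbolic

variable {X : Type*}

/-- A hyperbolic space structure: `W x y t` represents `(1-t)x ⊕ t y`. -/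
structure IsWMap [MetricSpace X] (W : X → X → ℝ → X) : Prop where
  w1 : ∀ (x y z : X), ∀ t ∈ Set.Icc (0:ℝ) 1,
    dist z (W x y t) ≤ (1 - t) * dist z x + t * dist z y
  w2 : ∀ (x y : X), ∀ t ∈ Set.Icc (0:ℝ) 1, ∀ s ∈ Set.Icc (0:ℝ) 1,
    dist (W x y t) (W x y s) = |t - s| * dist x y
  w3 : ∀ (x y : X), ∀ t ∈ Set.Icc (0:ℝ) 1, W x y t = W y x (1 - t)
  w4 : ∀ (x y z w : X), ∀ t ∈ Set.Icc (0:ℝ) 1,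
    dist (W x z t) (W y w t) ≤ (1 - t) * dist x y + t * dist z w

/-- `η` is a modulus of uniform convexity for the hyperbolic space `(X, dist, W)`. -/
def IsUCModulus [MetricSpace X] (W : X → X → ℝ → X) (η : ℝ → ℝ → ℝ) : Prop :=
  (∀ r ε : ℝ, 0 < r → ε ∈ Set.Ioc (0:ℝ) 2 → η r ε ∈ Set.Ioc (0:ℝ) 1) ∧
  (∀ r ε : ℝ, ∀ a x y : X, 0 < r → ε ∈ Set.Ioc (0:ℝ) 2 →
    dist x a ≤ r → dist y a ≤ r → ε * r ≤ dist x y →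
    dist (W x y (1/2)) a ≤ (1 - η r ε) * r)

/-- The modulus `η` is monotone: nonincreasing in `r` for each fixed `ε`. -/
def MonotoneUCModulus (η : ℝ → ℝ → ℝ) : Prop :=
  ∀ ε ∈ Set.Ioc (0:ℝ) 2, ∀ r s : ℝ, 0 < r → r ≤ s → η s ε ≤ η r ε

/-- `C` is a convex subset w.r.t. the convexity map `W`. -/
def WConvex [MetricSpace X] (W : X → X → ℝ → X) (C : Set X) : Prop :=
  ∀ x ∈ C, ∀ y ∈ C, ∀ t ∈ Set.Icc (0:ℝ) 1, W x y t ∈ C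

/-- `T : C → C` is asymptotically nonexpansive with sequence `k`. -/
def AsymptoticallyNonexpansive [MetricSpace X] (C : Set X) (T : X → X) (k : ℕ → ℝ) : Prop :=
  Set.MapsTo T C C ∧ (∀ n, 0 ≤ k n) ∧
  Filter.Tendsto k Filter.atTop (nhds 0) ∧
  ∀ n : ℕ, ∀ x ∈ C, ∀ y ∈ C, dist (T^[n] x) (T^[n] y) ≤ (1 + k n) * dist x y

/-- `xseq` is the Krasnoselski–Mann iteration of `T` starting from `x`:
`x₀ = x`, `x_{n+1} = (1-λ_n) x_n ⊕ λ_n T^n x_n`. -/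
def IsKMIteration [MetricSpace X] (W : X → X → ℝ → X) (T : X → X) (lam : ℕ → ℝ)
    (x : X) (xseq : ℕ → X) : Prop :=
  xseq 0 = x ∧ ∀ n, xseq (n + 1) = W (xseq n) (T^[n] (xseq n)) (lam n)

end Hyperbolic

section Hyperbolic

variable {X : Type*} [MetricSpace X] {W : X → X → ℝ → X} {η : ℝ → ℝ → ℝ}

/-- In a uniformly convex hyperbolic space, a point between `x` and `y` is determined by its
distances to `x` and `y`. -/
theorem IsUCModulus.eq_of_dist_le (hW : IsWMap W) (hUC : IsUCModulus W η) {x y z w : X} {s t : ℝ}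
    (hst : s + t ≤ dist x y) (hzx : dist z x ≤ s) (hwx : dist w x ≤ s)
    (hzy : dist z y ≤ t) (hwy : dist w y ≤ t) : z = w := by
  by_contra hne
  have hzw : 0 < dist z w := dist_pos.2 hne
  have htri : dist z w ≤ s + s := (dist_triangle_right z w x).trans (by linarith)
  have hs : 0 < s := by linarith
  have hε : dist z w / s ∈ Set.Ioc (0 : ℝ) 2 :=
    ⟨by positivity, by rw [div_le_iff₀ hs]; linarith⟩
  have hmx := hUC.2 s (dist z w / s) x z w hs hε hzx hwx (div_mul_cancel₀ _ hs.ne').le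
  have hη := (hUC.1 s _ hs hε).1
  have hmy := hW.w1 z w y (1 / 2) (by constructor <;> norm_num)
  have hxy := dist_triangle_left x y (W z w (1 / 2))
  rw [dist_comm y z, dist_comm y w, dist_comm y] at hmy
  nlinarith [mul_pos hη hs]

/-- Points of a segment arise from its midpoint by rescaling. -/
theorem IsUCModulus.apply_midpoint (hW : IsWMap W) (hUC : IsUCModulus W η) (x y : X) {t : ℝ}
    (ht : 0 ≤ t) (ht' : t ≤ 1 / 2) : W x (W x y (1 / 2)) (2 * t) = W x y t := by
  have hhalf : (1 / 2 : ℝ) ∈ Set.Icc (0 : ℝ) 1 := by constructor <;> norm_num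
  have h2t : 2 * t ∈ Set.Icc (0 : ℝ) 1 := ⟨by linarith, by linarith⟩
  have ht1 : t ∈ Set.Icc (0 : ℝ) 1 := ⟨ht, by linarith⟩
  have hmx := hW.w1 x y x _ hhalf
  have hmy := hW.w1 x y y _ hhalf
  have h1 := hW.w1 x (W x y (1 / 2)) x _ h2t
  have h2 := hW.w1 x (W x y (1 / 2)) y _ h2t
  have h3 := hW.w1 x y x _ ht1
  have h4 := hW.w1 x y y _ ht1
  simp only [dist_self, dist_comm y x] at hmx hmy h1 h2 h3 h4
  refine hUC.eq_of_dist_le hW (x := x) (y := y) (s := t * dist x y) (t := (1 - t) * dist x y)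
    (by linarith) ?_ ?_ ?_ ?_
  · rw [dist_comm]; nlinarith
  · rw [dist_comm]; linarith
  · rw [dist_comm]; nlinarith
  · rw [dist_comm]; linarith

theorem IsUCModulus.dist_le_of_le_half (hW : IsWMap W) (hUC : IsUCModulus W η) {r ε t : ℝ}
    {p x y : X} (hr : 0 < r) (hε : ε ∈ Set.Ioc (0 : ℝ) 2) (ht : 0 ≤ t) (ht' : t ≤ 1 / 2)
    (hx : dist x p ≤ r) (hy : dist y p ≤ r) (hxy : ε * r ≤ dist x y) :
    dist (W x y t) p ≤ (1 - 2 * t * (1 - t) * η r ε) * r := by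
  have hm := hUC.2 r ε p x y hr hε hx hy hxy
  have hη := (hUC.1 r ε hr hε).1
  have h := hW.w1 x (W x y (1 / 2)) p (2 * t) ⟨by linarith, by linarith⟩
  rw [hUC.apply_midpoint hW x y ht ht', dist_comm p, dist_comm p, dist_comm p] at h
  have h1 : (1 - 2 * t) * dist x p ≤ (1 - 2 * t) * r :=
    mul_le_mul_of_nonneg_left hx (by linarith)
  have h2 : 2 * t * dist (W x y (1 / 2)) p ≤ 2 * t * ((1 - η r ε) * r) :=
    mul_le_mul_of_nonneg_left hm (by linarith)
  nlinarith [mul_nonneg (mul_nonneg ht ht) (mul_pos hη hr).le]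

/-- Uniform convexity for arbitrary convex combinations. -/
theorem IsUCModulus.dist_le (hW : IsWMap W) (hUC : IsUCModulus W η) {r ε t : ℝ}
    {p x y : X} (hr : 0 < r) (hε : ε ∈ Set.Ioc (0 : ℝ) 2) (ht : t ∈ Set.Icc (0 : ℝ) 1)
    (hx : dist x p ≤ r) (hy : dist y p ≤ r) (hxy : ε * r ≤ dist x y) :
    dist (W x y t) p ≤ (1 - 2 * t * (1 - t) * η r ε) * r := by
  rcases le_total t (1 / 2) with h | h
  · exact hUC.dist_le_of_le_half hW hr hε ht.1 h hx hy hxy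
  · rw [hW.w3 x y t ht]
    convert hUC.dist_le_of_le_half hW hr hε (sub_nonneg.2 ht.2) (by linarith) hy hx
      (hxy.trans_eq (dist_comm x y)) using 1
    ring

end Hyperbolic

theorem le_mul_exp_sum_of_le_one_add_mul {u k : ℕ → ℝ} (hu : ∀ n, 0 ≤ u n)
    (h : ∀ n, u (n + 1) ≤ (1 + k n) * u n) (n : ℕ) :
    u n ≤ u 0 * Real.exp (∑ i ∈ Finset.range n, k i) := by
  induction n with
  | zero => simp
  | succ n ih =>
    rw [Finset.sum_range_succ, Real.exp_add]
    calc u (n + 1) ≤ (1 + k n) * u n := h n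
      _ ≤ Real.exp (k n) * u n := by
        have := Real.add_one_le_exp (k n)
        exact mul_le_mul_of_nonneg_right (by linarith) (hu n)
      _ ≤ Real.exp (k n) * (u 0 * Real.exp (∑ i ∈ Finset.range n, k i)) := by gcongr
      _ = _ := by ring

theorem exists_tendsto_of_le_add_summable {u v : ℕ → ℝ} (hu : ∀ n, 0 ≤ u n)
    (hv : ∀ n, 0 ≤ v n) (hsum : Summable v) (h : ∀ n, u (n + 1) ≤ u n + v n) :
    ∃ l, Tendsto u atTop (nhds l) := by
  have hanti : Antitone fun n => u n - ∑ i ∈ Finset.range n, v i :=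
    antitone_nat_of_succ_le fun n => by
      rw [Finset.sum_range_succ]; linarith [h n]
  have hbdd : BddBelow (Set.range fun n => u n - ∑ i ∈ Finset.range n, v i) := by
    refine ⟨-∑' i, v i, ?_⟩
    rintro _ ⟨n, rfl⟩
    have := hsum.sum_le_tsum (Finset.range n) fun i _ => hv i
    dsimp only
    linarith [hu n]
  refine ⟨_, ((tendsto_atTop_ciInf hanti hbdd).add hsum.hasSum.tendsto_sum_nat).congr
    fun n => ?_⟩
  ring

section KrasnoselskiMann

variable {X : Type*} [MetricSpace X] {W : X → X → ℝ → X} {η : ℝ → ℝ → ℝ} {C : Set X} {T : X → X}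
  {k lam : ℕ → ℝ} {x : X} {xseq : ℕ → X}

theorem IsKMIteration.mem (hconv : WConvex W C) (hT : Set.MapsTo T C C)
    (hlam : ∀ n, lam n ∈ Set.Icc (0 : ℝ) 1) (hx : x ∈ C) (h : IsKMIteration W T lam x xseq)
    (n : ℕ) : xseq n ∈ C := by
  induction n with
  | zero => rwa [h.1]
  | succ n ih => rw [h.2]; exact hconv _ ih _ (hT.iterate n ih) _ (hlam n)

theorem IsKMIteration.tendsto_dist_iterate (hW : IsWMap W) (hUC : IsUCModulus W η)
    (hMon : MonotoneUCModulus η) (hconv : WConvex W C) (hT : AsymptoticallyNonexpansive C T k)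
    (hsum : Summable k) {a b : ℝ} (ha : 0 < a) (hb : b < 1)
    (hlam : ∀ n, lam n ∈ Set.Icc a b) {p : X} (hp : p ∈ C) (hTp : T p = p) (hx : x ∈ C)
    (h : IsKMIteration W T lam x xseq) :
    Tendsto (fun n => dist (xseq n) (T^[n] (xseq n))) atTop (nhds 0) := by
  obtain ⟨hmaps, hk, hk0, hTk⟩ := hT
  have hlam' : ∀ n, lam n ∈ Set.Icc (0 : ℝ) 1 := fun n =>
    ⟨ha.le.trans (hlam n).1, (hlam n).2.trans hb.le⟩
  have hmem := h.mem hconv hmaps hlam' hx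
  have hy : ∀ n, dist (T^[n] (xseq n)) p ≤ (1 + k n) * dist (xseq n) p := fun n => by
    simpa only [Function.iterate_fixed hTp n] using hTk n _ (hmem n) p hp
  have hxr : ∀ n, dist (xseq n) p ≤ (1 + k n) * dist (xseq n) p := fun n => by
    nlinarith [mul_nonneg (hk n) (dist_nonneg (x := xseq n) (y := p))]
  have hstep : ∀ n, dist (xseq (n + 1)) p ≤ (1 + k n) * dist (xseq n) p := fun n => by
    have h1 := hW.w1 (xseq n) (T^[n] (xseq n)) p (lam n) (hlam' n)
    rw [← h.2, dist_comm p, dist_comm p, dist_comm p] at h1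
    have h2 := mul_le_mul_of_nonneg_left (hxr n) (sub_nonneg.2 (hlam' n).2)
    have h3 := mul_le_mul_of_nonneg_left (hy n) (hlam' n).1
    linarith
  obtain ⟨R, hR, hbd⟩ : ∃ R > 0, ∀ n, (1 + k n) * dist (xseq n) p ≤ R := by
    refine ⟨(1 + ∑' i, k i) * (dist (xseq 0) p * Real.exp (∑' i, k i)) + 1, ?_, fun n => ?_⟩
    · have : 0 ≤ ∑' i, k i := tsum_nonneg hk
      positivity
    · have h1 := le_mul_exp_sum_of_le_one_add_mul (u := fun n => dist (xseq n) p)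
        (fun _ => dist_nonneg) hstep n
      have h2 := hsum.sum_le_tsum (Finset.range n) fun i _ => hk i
      have h3 := hsum.le_tsum n fun i _ => hk i
      have h4 : dist (xseq n) p ≤ dist (xseq 0) p * Real.exp (∑' i, k i) :=
        h1.trans (by gcongr)
      have h5 : 0 ≤ 1 + ∑' i, k i := by linarith [hk n]
      have := mul_le_mul (add_le_add_right h3 1) h4 dist_nonneg h5
      linarith
  have hkd : ∀ n, k n * dist (xseq n) p ≤ R * k n := fun n => by
    rw [mul_comm R]
    exact mul_le_mul_of_nonneg_left ((hxr n).trans (hbd n)) (hk n)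
  obtain ⟨l, hl⟩ := exists_tendsto_of_le_add_summable (u := fun n => dist (xseq n) p)
    (v := fun n => R * k n) (fun _ => dist_nonneg) (fun n => mul_nonneg hR.le (hk n))
    (hsum.mul_left R) fun n => by
      linarith [hstep n, hkd n]
  have hdrop : Tendsto (fun n => dist (xseq n) p - dist (xseq (n + 1)) p + R * k n) atTop
      (nhds 0) := by
    simpa using (hl.sub (hl.comp (tendsto_add_atTop_nat 1))).add (hk0.const_mul R)
  refine tendsto_order.2 ⟨fun c hc => Eventually.of_forall fun n => hc.trans_le dist_nonneg,
    fun δ hδ => ?_⟩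
  rcases lt_or_ge (2 * R) δ with hRδ | hδR
  · refine Eventually.of_forall fun n => ?_
    have := dist_triangle_right (xseq n) (T^[n] (xseq n)) p
    linarith [hbd n, hxr n, hy n]
  have hε : δ / R ∈ Set.Ioc (0 : ℝ) 2 := ⟨by positivity, by rwa [div_le_iff₀ hR]⟩
  have hη := (hUC.1 R _ hR hε).1
  have hb' : 0 < 1 - b := by linarith
  filter_upwards [hdrop.eventually_lt_const (show 0 < a * (1 - b) * η R (δ / R) * δ by positivity)]
    with n hn
  by_contra! hge
  set r := (1 + k n) * dist (xseq n) p with hr_def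
  have hδr : δ ≤ 2 * r := by
    have := dist_triangle_right (xseq n) (T^[n] (xseq n)) p
    linarith [hxr n, hy n]
  have hr : 0 < r := by linarith
  have hεr : δ / R * r ≤ dist (xseq n) (T^[n] (xseq n)) := by
    refine le_trans ?_ hge
    rw [div_mul_eq_mul_div, div_le_iff₀ hR]
    exact mul_le_mul_of_nonneg_left (hbd n) hδ.le
  have hmain := hUC.dist_le hW hr hε (hlam' n) (hxr n) (hy n) hεr
  rw [← h.2] at hmain
  have hmono := hMon _ hε r R hr (hbd n)
  have hcoef : a * (1 - b) * η R (δ / R) * δ ≤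
      lam n * (1 - lam n) * η r (δ / R) * (2 * r) := by
    have h0 := (hlam' n).1
    have h1 := sub_nonneg.2 (hlam' n).2
    have h2 := (hlam n).1
    have h3 : 1 - b ≤ 1 - lam n := by linarith [(hlam n).2]
    have h4 := hη.le.trans hmono
    gcongr
  linarith [hkd n, hr_def]

end KrasnoselskiMann

/-- (Theorem 5.3 of the paper) if `T` has a fixed point then `T` is
`λₙ`-asymptotically regular, for `λₙ ∈ [a,b] ⊆ (0,1)` and `∑ kᵢ < ∞`. -/
theorem asymptotic_regularity_original
    {X : Type*} [MetricSpace X] [Nonempty X]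
    (W : X → X → ℝ → X) (η : ℝ → ℝ → ℝ)
    (hW : IsWMap W) (hUC : IsUCModulus W η) (hMon : MonotoneUCModulus η)
    (C : Set X) (hne : C.Nonempty) (hconv : WConvex W C)
    (T : X → X) (k : ℕ → ℝ) (hT : AsymptoticallyNonexpansive C T k)
    (hsum : Summable k)
    (a b : ℝ) (ha : 0 < a) (hab : a < b) (hb : b < 1)
    (lam : ℕ → ℝ) (hlam : ∀ n, lam n ∈ Set.Icc a b)
    (hfix : ∃ p ∈ C, T p = p) :
    ∀ x ∈ C, ∀ xseq : ℕ → X, IsKMIteration W T lam x xseq →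
      Filter.Tendsto (fun n => dist (xseq n) (T (xseq n))) Filter.atTop (nhds 0) := by
  intro x hx xseq h
  obtain ⟨p, hp, hTp⟩ := hfix
  have he := h.tendsto_dist_iterate hW hUC hMon hconv hT hsum ha hb hlam hp hTp hx
  obtain ⟨hmaps, hk, hk0, hTk⟩ := hT
  have hlam' : ∀ n, lam n ∈ Set.Icc (0 : ℝ) 1 := fun n =>
    ⟨ha.le.trans (hlam n).1, (hlam n).2.trans hb.le⟩
  have hmem := h.mem hconv hmaps hlam' hx
  have hlim : Tendsto (fun n => dist (xseq (n + 1)) (T^[n + 1] (xseq (n + 1))) +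
      (1 + k 1) * ((3 + k n) * dist (xseq n) (T^[n] (xseq n)))) atTop (nhds 0) := by
    simpa using (he.comp (tendsto_add_atTop_nat 1)).add
      (((hk0.const_add 3).mul he).const_mul (1 + k 1))
  rw [← tendsto_add_atTop_iff_nat 1]
  refine squeeze_zero (fun _ => dist_nonneg) (fun n => ?_) hlim
  have hstep : dist (xseq n) (xseq (n + 1)) ≤ dist (xseq n) (T^[n] (xseq n)) := by
    have h1 := hW.w1 (xseq n) (T^[n] (xseq n)) (xseq n) (lam n) (hlam' n)
    rw [← h.2, dist_self, mul_zero, zero_add] at h1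
    exact h1.trans (mul_le_of_le_one_left dist_nonneg (hlam' n).2)
  have hTn := hTk n _ (hmem (n + 1)) _ (hmem n)
  rw [dist_comm (xseq (n + 1)) (xseq n)] at hTn
  have hTn' := mul_le_mul_of_nonneg_left hstep (show 0 ≤ 1 + k n by linarith [hk n])
  have htri := dist_triangle4 (T^[n] (xseq (n + 1))) (T^[n] (xseq n)) (xseq n) (xseq (n + 1))
  rw [dist_comm (T^[n] (xseq n)) (xseq n)] at htri
  have hT1 := hTk 1 _ (hmaps.iterate n (hmem (n + 1))) _ (hmem (n + 1))
  rw [Function.iterate_one, ← Function.iterate_succ_apply' T] at hT1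
  refine (dist_triangle _ (T^[n + 1] (xseq (n + 1))) _).trans ?_
  gcongr
  refine hT1.trans (mul_le_mul_of_nonneg_left ?_ (by linarith [hk 1]))
  linarith
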